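/- Let (Ω, 𝔉, (𝔉_t)_{t∈[0,T]}, ℙ) be a filtered probability space carrying a standard one-dimensional Brownian motion W adapted to (𝔉_t), let b̃ : [0,T] × ℝ → ℝ be bounded and (jointly) measurable, and let x ∈ ℝ. Suppose X : [0,T] × Ω → ℝ is a continuous adapted process such that for every t ∈ [0,T], ℙ-almost surely X_t = x + ∫₀ᵗ b̃(s, X_s) ds + W_t. Then for every t ∈ (0,T] the law of X_t (the pushforward of ℙ under X_t) is absolutely continuous with respect to Lebesgue measure on ℝ. -/

import Mathlib

open MeasureTheory ProbabilityTheory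

open scoped SchwartzMap FourierTransform in
/-- Pairing a Schwartz function with a finite measure, read on the Fourier side. -/
theorem SchwartzMap.integral_eq_integral_fourier_mul_charFun (f : 𝓢(ℝ, ℂ)) (μ : Measure ℝ)
    [IsFiniteMeasure μ] :
    ∫ y, f y ∂μ = ∫ w, 𝓕 f w * charFun μ (2 * Real.pi * w) := by
  have hinv (y : ℝ) : f y = ∫ w : ℝ, Complex.exp (2 * Real.pi * w * y * Complex.I) * 𝓕 f w := by
    have h : 𝓕⁻ (𝓕 f) = f := FourierTransform.fourierInv_fourier_eq f
    rw [← congrArg (fun g : 𝓢(ℝ, ℂ) => g y) h, SchwartzMap.fourierInv_coe, Real.fourierInv_eq']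
    refine integral_congr_ae (.of_forall fun w => ?_)
    simp only [smul_eq_mul, RCLike.inner_apply, conj_trivial]
    congr 2
    push_cast
    ring
  simp_rw [hinv]
  rw [integral_integral_swap]
  · refine integral_congr_ae (.of_forall fun w => ?_)
    simp only
    rw [integral_mul_const, charFun_apply_real, mul_comm]
    push_cast
    rfl
  · have hint : Integrable (fun p : ℝ × ℝ => 𝓕 f p.2) (μ.prod volume) :=
      (𝓕 f).integrable.comp_snd μ
    refine hint.mono ((Continuous.aestronglyMeasurable (by fun_prop)).mul
      hint.aestronglyMeasurable) (.of_forall fun p => ?_)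
    simp only [Function.uncurry, norm_mul]
    rw [show (2 * Real.pi * p.2 * p.1 * Complex.I : ℂ)
      = ((2 * Real.pi * p.2 * p.1 : ℝ) : ℂ) * Complex.I by push_cast; ring,
      Complex.norm_exp_ofReal_mul_I, one_mul]

open scoped SchwartzMap FourierTransform in
theorem SchwartzMap.norm_integral_le_of_memLp_charFun (f : 𝓢(ℝ, ℂ)) (μ : Measure ℝ)
    [IsFiniteMeasure μ] (hμ : MemLp (charFun μ) 2) :
    ‖∫ y, f y ∂μ‖ ≤ (∫ y, ‖f y‖ ^ 2) ^ (1 / 2 : ℝ)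
      * (∫ w, ‖charFun μ (2 * Real.pi * w)‖ ^ 2) ^ (1 / 2 : ℝ) := by
  have hscaled : MemLp (fun w => charFun μ (2 * Real.pi * w)) 2 := by
    have hmeas : Measurable fun w => charFun μ (2 * Real.pi * w) :=
      measurable_charFun.comp (by fun_prop)
    rw [memLp_two_iff_integrable_sq_norm hmeas.aestronglyMeasurable]
    exact ((memLp_two_iff_integrable_sq_norm measurable_charFun.aestronglyMeasurable).1
      hμ).comp_mul_left' (by positivity)
  rw [f.integral_eq_integral_fourier_mul_charFun μ, ← f.integral_norm_sq_fourier]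
  refine (norm_integral_le_integral_norm _).trans ?_
  simp_rw [norm_mul]
  have := integral_mul_norm_le_Lp_mul_Lq (μ := volume) Real.HolderConjugate.two_two
    (f := fun w => 𝓕 f w) (g := fun w => charFun μ (2 * Real.pi * w))
    (by simpa using (𝓕 f).memLp 2) (by simpa using hscaled)
  simpa using this

open scoped ContDiff in
/-- A compact set has a smooth, compactly supported cutoff inside any open neighbourhood. -/
theorem IsCompact.exists_contDiff_cutoff {K U : Set ℝ} (hK : IsCompact K) (hU : IsOpen U)
    (hKU : K ⊆ U) :
    ∃ f : ℝ → ℝ, ContDiff ℝ ∞ f ∧ HasCompactSupport f ∧ Function.support f ⊆ U ∧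
      (∀ y, f y ∈ Set.Icc (0 : ℝ) 1) ∧ ∀ y ∈ K, f y = 1 := by
  obtain ⟨L, hL, hKL, hLU⟩ := exists_compact_between hK hU hKU
  obtain ⟨f, hf, hrange, hsupp, hone⟩ := exists_contMDiff_support_eq_eq_one_iff
    (n := ⊤) (modelWithCornersSelf ℝ ℝ) isOpen_interior hK.isClosed hKL
  refine ⟨f, hf.contDiff, ?_, ?_, fun y => hrange ⟨y, rfl⟩, fun y hy => (hone y).1 hy⟩
  · refine HasCompactSupport.intro hL fun y hy => Function.notMem_support.1 fun hy' => hy ?_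
    exact interior_subset (hsupp ▸ hy')
  · exact hsupp.subset.trans (interior_subset.trans hLU)

/-- A finite measure on `ℝ` whose characteristic function is square integrable has a density. -/
theorem MeasureTheory.Measure.absolutelyContinuous_of_memLp_charFun (μ : Measure ℝ)
    [IsFiniteMeasure μ] (hμ : MemLp (charFun μ) 2) : μ ≪ volume := by
  set A := (∫ w, ‖charFun μ (2 * Real.pi * w)‖ ^ 2) ^ (1 / 2 : ℝ)
  have hA : 0 ≤ A := by positivity
  have hopen {K U : Set ℝ} (hK : IsCompact K) (hU : IsOpen U) (hKU : K ⊆ U)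
      (hfin : volume U ≠ ⊤) : μ.real K ≤ volume.real U ^ (1 / 2 : ℝ) * A := by
    obtain ⟨f, hf, hcomp, hsupp, hrange, hone⟩ := hK.exists_contDiff_cutoff hU hKU
    have hcompC : HasCompactSupport fun y => (f y : ℂ) := hcomp.comp_left (g := Complex.ofReal) rfl
    let g : SchwartzMap ℝ ℂ :=
      hcompC.toSchwartzMap (Complex.ofRealCLM.contDiff.comp hf)
    have hg (y : ℝ) : g y = f y := rfl
    have hint : Integrable f μ := hf.continuous.integrable_of_hasCompactSupport hcomp
    have hlower : μ.real K ≤ ‖∫ y, g y ∂μ‖ := by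
      simp_rw [hg]
      rw [integral_complex_ofReal, Complex.norm_real]
      refine le_trans ?_ (le_abs_self _)
      rw [← integral_indicator_one hK.measurableSet]
      refine integral_mono ((integrable_const 1).indicator hK.measurableSet) hint fun y => ?_
      by_cases hy : y ∈ K
      · simp [hy, hone y hy]
      · simpa [hy] using (hrange y).1
    have hupper : ∫ y, ‖g y‖ ^ 2 ≤ volume.real U := by
      rw [← integral_indicator_one hU.measurableSet]
      refine integral_mono_of_nonneg (.of_forall fun y => by positivity)
        ((integrable_indicator_iff hU.measurableSet).2 (integrableOn_const hfin))
        (.of_forall fun y => ?_)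
      by_cases hy : y ∈ U
      · simpa [hy, hg] using abs_le.2 ⟨by linarith [(hrange y).1], (hrange y).2⟩
      · have : f y = 0 := Function.notMem_support.1 fun h => hy (hsupp h)
        simp [hy, hg, this]
    calc μ.real K ≤ ‖∫ y, g y ∂μ‖ := hlower
      _ ≤ (∫ y, ‖g y‖ ^ 2) ^ (1 / 2 : ℝ) * A := g.norm_integral_le_of_memLp_charFun μ hμ
      _ ≤ _ := by gcongr
  refine Measure.AbsolutelyContinuous.mk fun S hS hS0 => ?_
  rw [hS.measure_eq_iSup_isCompact]
  simp only [ENNReal.iSup_eq_zero]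
  intro K hKS hK
  have hK0 : volume K = 0 := measure_mono_null hKS hS0
  have hzero : μ.real K ≤ 0 := by
    have hsmall (δ : ℝ) (hδ : 0 < δ) : μ.real K ≤ δ ^ (1 / 2 : ℝ) * A := by
      obtain ⟨U, hKU, hU, hUδ⟩ := K.exists_isOpen_lt_of_lt (μ := volume) (ENNReal.ofReal δ)
        (by simpa [hK0] using hδ)
      refine (hopen hK hU hKU hUδ.ne_top).trans ?_
      gcongr
      exact ENNReal.toReal_le_of_le_ofReal hδ.le hUδ.le
    have hlim : Filter.Tendsto (fun δ : ℝ => δ ^ (1 / 2 : ℝ) * A)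
        (nhdsWithin 0 (Set.Ioi 0)) (nhds 0) := by
      have : Continuous fun δ : ℝ => δ ^ (1 / 2 : ℝ) * A :=
        (Real.continuous_rpow_const (by norm_num)).mul continuous_const
      simpa using (this.tendsto 0).mono_left nhdsWithin_le_nhds
    exact ge_of_tendsto hlim (Filter.eventually_of_mem self_mem_nhdsWithin hsmall)
  exact (measureReal_eq_zero_iff).1 (hzero.antisymm measureReal_nonneg)

theorem norm_charFun_map_sub_le {Ω : Type*} {mΩ : MeasurableSpace Ω} (P : Measure Ω)
    [IsProbabilityMeasure P] {Y Z : Ω → ℝ} (hY : AEMeasurable Y P) (hZ : AEMeasurable Z P)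
    {δ : ℝ} (h : ∀ᵐ ω ∂P, |Y ω - Z ω| ≤ δ) (ξ : ℝ) :
    ‖charFun (P.map Y) ξ - charFun (P.map Z) ξ‖ ≤ |ξ| * δ := by
  have hint {V : Ω → ℝ} (hV : AEMeasurable V P) :
      Integrable (fun ω => Complex.exp (ξ * V ω * Complex.I)) P := by
    refine Integrable.of_bound (C := 1) (by fun_prop) (.of_forall fun ω => ?_)
    exact_mod_cast (Complex.norm_exp_ofReal_mul_I (ξ * V ω)).le
  rw [charFun_apply_real, charFun_apply_real, integral_map hY (by fun_prop),
    integral_map hZ (by fun_prop), ← integral_sub (hint hY) (hint hZ)]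
  have hbound : ∀ᵐ ω ∂P, ‖Complex.exp (ξ * Y ω * Complex.I) - Complex.exp (ξ * Z ω * Complex.I)‖
      ≤ |ξ| * δ := by
    filter_upwards [h] with ω hω
    have hfactor : Complex.exp (ξ * Y ω * Complex.I) - Complex.exp (ξ * Z ω * Complex.I)
        = Complex.exp ((ξ * Z ω : ℝ) * Complex.I)
          * (Complex.exp (Complex.I * (ξ * (Y ω - Z ω) : ℝ)) - 1) := by
      rw [mul_sub, ← Complex.exp_add, mul_one]
      push_cast
      congr 2
      ring
    rw [hfactor, norm_mul, Complex.norm_exp_ofReal_mul_I, one_mul]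
    refine Real.norm_exp_I_mul_ofReal_sub_one_le.trans ?_
    rw [norm_mul]
    exact mul_le_mul_of_nonneg_left hω (abs_nonneg ξ)
  simpa using norm_integral_le_of_norm_le_const hbound

theorem norm_charFun_map_add_gaussian {Ω : Type*} {mΩ : MeasurableSpace Ω} (P : Measure Ω)
    [IsProbabilityMeasure P] {Y G : Ω → ℝ} (hY : AEMeasurable Y P) (hG : AEMeasurable G P)
    (hYG : IndepFun Y G P) {v : NNReal} (hlaw : P.map G = gaussianReal 0 v) (ξ : ℝ) :
    ‖charFun (P.map (fun ω => Y ω + G ω)) ξ‖ ≤ Real.exp (-(v * ξ ^ 2 / 2)) := by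
  rw [hYG.charFun_map_fun_add_eq_mul hY hG, Pi.mul_apply, norm_mul, hlaw, charFun_gaussianReal]
  have := Measure.isProbabilityMeasure_map hY (μ := P)
  refine (mul_le_of_le_one_left (norm_nonneg _) (norm_charFun_le_one ξ)).trans ?_
  rw [Complex.norm_exp]
  refine (congrArg Real.exp ?_).le
  rw [show (ξ * (0 : ℝ) * Complex.I - (v : ℝ) * ξ ^ 2 / 2 : ℂ)
    = ((-(v * ξ ^ 2 / 2) : ℝ) : ℂ) by push_cast; ring, Complex.ofReal_re]

/-- A characteristic function bounded by `exp (-ξ² ε / 2) + C |ξ| ε` for all small `ε` is square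
integrable: take `ε` of order `|ξ| ^ (-7 / 4)`. -/
theorem memLp_two_of_forall_norm_le_exp_add {φ : ℝ → ℂ} (hφ : Measurable φ) {t C : ℝ} (ht : 0 < t)
    (hC : 0 ≤ C)
    (h : ∀ ξ, ∀ ε ∈ Set.Ioc 0 t, ‖φ ξ‖ ≤ Real.exp (-(ε * ξ ^ 2 / 2)) + |ξ| * (C * ε)) :
    MemLp φ 2 := by
  set M := Real.exp (t / 2) * (6 * (4 / t) ^ 3) + C * t
  have hdecay (ξ : ℝ) : ‖φ ξ‖ ≤ M * (1 + ‖ξ‖) ^ (-(3 / 4) : ℝ) := by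
    have hu : 0 ≤ 1 + |ξ| := by positivity
    obtain ⟨s, hs1, hs4, hs3⟩ : ∃ s : ℝ, 1 ≤ s ∧ s ^ 4 = 1 + |ξ| ∧
        (1 + ‖ξ‖) ^ (-(3 / 4) : ℝ) = 1 / s ^ 3 := by
      refine ⟨(1 + |ξ|) ^ (1 / 4 : ℝ), Real.one_le_rpow (by simp) (by norm_num), ?_, ?_⟩
      · rw [← Real.rpow_natCast, ← Real.rpow_mul hu]
        norm_num
      · rw [← Real.rpow_natCast, ← Real.rpow_mul hu, one_div, ← Real.rpow_neg hu, Real.norm_eq_abs]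
        norm_num
    have hs0 : 0 < s := by linarith
    have hs7 : 1 ≤ s ^ 7 := one_le_pow₀ hs1
    have hdrift : |ξ| * (C * (t / s ^ 7)) ≤ C * t * (1 / s ^ 3) := by
      calc |ξ| * (C * (t / s ^ 7)) ≤ s ^ 4 * (C * (t / s ^ 7)) := by
            gcongr
            linarith
        _ = C * t * (1 / s ^ 3) := by field_simp
    have hexponent : -(t / s ^ 7 * ξ ^ 2 / 2) ≤ t / 2 + -(t * s / 4) := by
      have hsq : s ^ 8 / 2 - 1 ≤ ξ ^ 2 := by
        have : s ^ 8 = (1 + |ξ|) ^ 2 := by rw [← hs4]; ring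
        rw [this, ← sq_abs ξ]
        nlinarith [sq_nonneg (|ξ| - 1)]
      have hsplit : t / s ^ 7 * (s ^ 8 / 2 - 1) / 2 = t * s / 4 - t / s ^ 7 / 2 := by
        field_simp
        ring
      have hle : t / s ^ 7 ≤ t := div_le_self ht.le hs7
      have : t / s ^ 7 * (s ^ 8 / 2 - 1) / 2 ≤ t / s ^ 7 * ξ ^ 2 / 2 := by gcongr
      linarith
    have hgauss : Real.exp (-(t * s / 4)) ≤ 6 * (4 / t) ^ 3 * (1 / s ^ 3) := by
      have hpow := Real.pow_div_factorial_le_exp (x := t * s / 4) (by positivity) 3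
      rw [Real.exp_neg]
      refine (inv_anti₀ (by positivity) hpow).trans_eq ?_
      norm_num [Nat.factorial]
      field_simp
    calc ‖φ ξ‖ ≤ Real.exp (-(t / s ^ 7 * ξ ^ 2 / 2)) + |ξ| * (C * (t / s ^ 7)) :=
          h ξ _ ⟨by positivity, div_le_self ht.le hs7⟩
      _ ≤ Real.exp (t / 2) * (6 * (4 / t) ^ 3 * (1 / s ^ 3)) + C * t * (1 / s ^ 3) := by
          refine add_le_add ((Real.exp_le_exp.2 hexponent).trans ?_) hdrift
          rw [Real.exp_add]
          gcongr
      _ = M * (1 + ‖ξ‖) ^ (-(3 / 4) : ℝ) := by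
          rw [hs3]
          ring
  have hbound : MemLp (fun ξ : ℝ => M * (1 + ‖ξ‖) ^ (-(3 / 4) : ℝ)) 2 := by
    refine MemLp.const_mul ?_ M
    rw [memLp_two_iff_integrable_sq (Measurable.aestronglyMeasurable (by fun_prop))]
    refine (integrable_one_add_norm (E := ℝ) (μ := volume) (r := 3 / 2) (by norm_num)).congr
      (.of_forall fun ξ => ?_)
    have : 0 ≤ 1 + ‖ξ‖ := by positivity
    simp only
    rw [← Real.rpow_natCast, ← Real.rpow_mul this]
    norm_num
  exact hbound.mono hφ.aestronglyMeasurable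
    (.of_forall fun ξ => (hdecay ξ).trans (le_abs_self _))

/-- Theorem `densX`: for the one-dimensional SDE `X_t = x + ∫₀ᵗ b̃(s,X_s) ds + W_t`
with bounded measurable drift `b̃` and `W` a standard Brownian motion, the law of
`X_t` is absolutely continuous with respect to Lebesgue measure for every
`t ∈ (0,T]`. -/
theorem density_forward_component
    {Ω : Type*} {mΩ : MeasurableSpace Ω} (P : Measure Ω) [IsProbabilityMeasure P]
    (ℱ : Filtration ℝ mΩ)
    (T : ℝ) (hT : 0 < T)
    (W : ℝ → Ω → ℝ)
    (hW0 : ∀ᵐ ω ∂P, W 0 ω = 0)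
    (hWcont : ∀ᵐ ω ∂P, Continuous fun t => W t ω)
    (hWadapted : Adapted ℱ W)
    (hWindep : ∀ s t : ℝ, 0 ≤ s → s ≤ t →
      Indep (MeasurableSpace.comap (fun ω => W t ω - W s ω) inferInstance) (ℱ s) P)
    (hWgauss : ∀ s t : ℝ, 0 ≤ s → s ≤ t →
      Measure.map (fun ω => W t ω - W s ω) P = gaussianReal 0 (Real.toNNReal (t - s)))
    (btilde : ℝ → ℝ → ℝ)
    (hb_meas : Measurable (Function.uncurry btilde))
    (Cb : ℝ) (hb_bd : ∀ t x, |btilde t x| ≤ Cb)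
    (x : ℝ)
    (X : ℝ → Ω → ℝ)
    (hXcont : ∀ᵐ ω ∂P, Continuous fun t => X t ω)
    (hXadapted : Adapted ℱ X)
    (hX : ∀ t ∈ Set.Icc (0:ℝ) T, ∀ᵐ ω ∂P,
      X t ω = x + (∫ s in (0:ℝ)..t, btilde s (X s ω)) + W t ω) :
    ∀ t ∈ Set.Ioc (0:ℝ) T, Measure.map (X t) P ≪ (volume : Measure ℝ) := by
  intro t ht
  have hCb : 0 ≤ Cb := (abs_nonneg _).trans (hb_bd 0 0)
  have hXmeas (s : ℝ) : Measurable (X s) := (hXadapted s).mono (ℱ.le s) le_rfl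
  have hWmeas (s : ℝ) : Measurable (W s) := (hWadapted s).mono (ℱ.le s) le_rfl
  have := Measure.isProbabilityMeasure_map (μ := P) (hXmeas t).aemeasurable
  apply Measure.absolutelyContinuous_of_memLp_charFun
  refine memLp_two_of_forall_norm_le_exp_add measurable_charFun ht.1 hCb fun ξ ε hε => ?_
  have hr0 : 0 ≤ t - ε := sub_nonneg.2 hε.2
  have hrt : t - ε ≤ t := sub_le_self t hε.1.le
  have hclose : ∀ᵐ ω ∂P, |X t ω - (X (t - ε) ω + (W t ω - W (t - ε) ω))| ≤ Cb * ε := by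
    filter_upwards [hX t ⟨ht.1.le, ht.2⟩, hX (t - ε) ⟨hr0, hrt.trans ht.2⟩, hXcont]
      with ω h1 h2 hcont
    have hint (a b : ℝ) : IntervalIntegrable (fun s => btilde s (X s ω)) volume a b := by
      refine (intervalIntegrable_const (c := Cb)).mono_fun
        (hb_meas.comp (measurable_id.prodMk hcont.measurable)).aestronglyMeasurable
        (.of_forall fun s => ?_)
      exact (hb_bd s (X s ω)).trans (le_abs_self Cb)
    have hdiff : X t ω - (X (t - ε) ω + (W t ω - W (t - ε) ω))
        = ∫ s in (t - ε)..t, btilde s (X s ω) := by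
      rw [← intervalIntegral.integral_interval_sub_left (hint 0 t) (hint 0 (t - ε))]
      linarith
    rw [hdiff]
    refine (intervalIntegral.norm_integral_le_of_norm_le_const
      (f := fun s => btilde s (X s ω)) fun s _ => hb_bd s (X s ω)).trans_eq ?_
    rw [sub_sub_cancel, abs_of_pos hε.1]
  have hindep : IndepFun (X (t - ε)) (fun ω => W t ω - W (t - ε) ω) P :=
    (indep_of_indep_of_le_right (hWindep (t - ε) t hr0 hrt) (hXadapted (t - ε)).comap_le).symm
  have hY := (hXmeas (t - ε)).aemeasurable (μ := P)
  have hG := ((hWmeas t).sub (hWmeas (t - ε))).aemeasurable (μ := P)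
  have hgauss := norm_charFun_map_add_gaussian P hY hG hindep (hWgauss (t - ε) t hr0 hrt) ξ
  rw [sub_sub_cancel, Real.coe_toNNReal ε hε.1.le] at hgauss
  have hpert := norm_charFun_map_sub_le P (hXmeas t).aemeasurable (hY.add hG) hclose ξ
  refine (norm_le_norm_add_norm_sub' _ _).trans (add_le_add hgauss hpert)
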